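/- Let h : (ℤ/(MN)ℤ)² → ℂ and x : ℤ/(MN)ℤ → ℂ, and define the noiseless received signal y : ℤ/(MN)ℤ → ℂ by y[n'] = Σ_{k,l ∈ ℤ/(MN)ℤ} h[k,l] · x[n'−k] · e^{(2πi/(MN)) l (n'−k)}. Then for all k', l' ∈ ℤ/(MN)ℤ, the cross-ambiguity of y with x is the twisted convolution of h with the self-ambiguity of x: A_{y,x}[k', l'] = Σ_{k,l ∈ ℤ/(MN)ℤ} h[k,l] · A_x[k'−k, l'−l] · e^{(2πi/(MN)) l (k'−k)}. -/

import Mathlib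

open Finset

/-- e^{2πi t / Q} for an integer `t` and modulus `Q`. -/
noncomputable def eFrac (Q : ℕ) (t : ℤ) : ℂ :=
  Complex.exp (2 * Real.pi * Complex.I * (t : ℂ) / (Q : ℂ))

/-- Generalized discrete affine Fourier transform (GDAFT). -/
noncomputable def gdaft (M N : ℕ) (A B C : ℤ) (x : ZMod (M * N) → ℂ) :
    ZMod (M * N) → ℂ :=
  fun n => (Real.sqrt (M * N) : ℂ)⁻¹ *
    ∑ m ∈ Finset.range (M * N),
      eFrac (M * N) (A * (n.val : ℤ) ^ 2 + B * (n.val : ℤ) * (m : ℤ) + C * (m : ℤ) ^ 2) *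
        x (m : ZMod (M * N))

/-- Inverse GDAFT. -/
noncomputable def igdaft (M N : ℕ) (A B C : ℤ) (x : ZMod (M * N) → ℂ) :
    ZMod (M * N) → ℂ :=
  fun m => (Real.sqrt (M * N) : ℂ)⁻¹ *
    ∑ n ∈ Finset.range (M * N),
      eFrac (M * N) (-(A * (n : ℤ) ^ 2 + B * (n : ℤ) * (m.val : ℤ) + C * (m.val : ℤ) ^ 2)) *
        x (n : ZMod (M * N))

/-- The pulsone localized at `(k0, l0)`. -/
noncomputable def pulsone (M N : ℕ) (k0 l0 : ℕ) : ZMod (M * N) → ℂ :=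
  fun n => if n.val % M = k0 then
    (Real.sqrt N : ℂ)⁻¹ * eFrac N ((n.val / M : ℕ) * l0) else 0

/-- Cross-ambiguity function of two `MN`-periodic sequences. -/
noncomputable def amb (M N : ℕ) (y x : ZMod (M * N) → ℂ) (k l : ZMod (M * N)) : ℂ :=
  ((M * N : ℕ) : ℂ)⁻¹ * ∑ n ∈ Finset.range (M * N),
    y (n : ZMod (M * N)) * (starRingEnd ℂ) (x ((n : ZMod (M * N)) - k)) *
      eFrac (M * N) (-((l * ((n : ZMod (M * N)) - k)).val : ℤ))

/-- Delay-Doppler shift operator. -/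
noncomputable def ddShift (M N : ℕ) (k l : ZMod (M * N)) (x : ZMod (M * N) → ℂ) :
    ZMod (M * N) → ℂ :=
  fun n => x (n - k) * eFrac (M * N) ((l * (n - k)).val : ℤ)

/-- Inner product ⟨x, y⟩ = Σ x[n] conj(y[n]). -/
noncomputable def innerMN (M N : ℕ) (x y : ZMod (M * N) → ℂ) : ℂ :=
  ∑ n ∈ Finset.range (M * N),
    x (n : ZMod (M * N)) * (starRingEnd ℂ) (y (n : ZMod (M * N)))


theorem eFrac_eq_stdAddChar (Q : ℕ) [NeZero Q] (t : ℤ) :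
    eFrac Q t = ZMod.stdAddChar (t : ZMod Q) := by
  rw [ZMod.stdAddChar_coe, eFrac]

theorem eFrac_val (Q : ℕ) [NeZero Q] (a : ZMod Q) :
    eFrac Q (a.val : ℤ) = ZMod.stdAddChar a := by
  simp [eFrac_eq_stdAddChar]

theorem eFrac_neg_val (Q : ℕ) [NeZero Q] (a : ZMod Q) :
    eFrac Q (-(a.val : ℤ)) = ZMod.stdAddChar (-a) := by
  simp [eFrac_eq_stdAddChar]

theorem sum_range_natCast_zmod {R : Type*} [AddCommMonoid R] (Q : ℕ) [NeZero Q]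
    (f : ZMod Q → R) : ∑ n ∈ Finset.range Q, f (n : ZMod Q) = ∑ n : ZMod Q, f n := by
  refine Finset.sum_bij' (fun n _ => (n : ZMod Q)) (fun a _ => a.val) ?_ ?_ ?_ ?_ ?_
  · simp
  · intro a _
    simpa using ZMod.val_lt a
  · intro n hn
    exact ZMod.val_cast_of_lt (Finset.mem_range.mp hn)
  · simp
  · simp

theorem amb_eq_sum_zmod (M N : ℕ) [NeZero (M * N)] (y x : ZMod (M * N) → ℂ)
    (k l : ZMod (M * N)) :
    amb M N y x k l = ((M * N : ℕ) : ℂ)⁻¹ * ∑ n : ZMod (M * N),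
      y n * (starRingEnd ℂ) (x (n - k)) * ZMod.stdAddChar (-(l * (n - k))) := by
  simp only [amb, eFrac_neg_val]
  rw [sum_range_natCast_zmod (M * N) fun n =>
    y n * (starRingEnd ℂ) (x (n - k)) * ZMod.stdAddChar (-(l * (n - k)))]

/-- **Cross-ambiguity of channel output with input is a twisted convolution.**
If `y[n'] = Σ_{k,l} h[k,l] x[n'−k] e^{(2πi/(MN)) l (n'−k)}`, then
`A_{y,x}[k',l'] = Σ_{k,l} h[k,l] A_x[k'−k, l'−l] e^{(2πi/(MN)) l (k'−k)}`. -/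
theorem amb_twisted_convolution (M N : ℕ) (hM : 0 < M) (hN : 0 < N)
    (h : ZMod (M * N) × ZMod (M * N) → ℂ) (x y : ZMod (M * N) → ℂ)
    (hy : ∀ n' : ZMod (M * N),
      y n' = ∑ k ∈ Finset.range (M * N), ∑ l ∈ Finset.range (M * N),
        h ((k : ZMod (M * N)), (l : ZMod (M * N))) * x (n' - (k : ZMod (M * N))) *
          eFrac (M * N) ((((l : ZMod (M * N)) * (n' - (k : ZMod (M * N)))).val : ℤ))) :
    ∀ k' l' : ZMod (M * N),
      amb M N y x k' l' =
        ∑ k ∈ Finset.range (M * N), ∑ l ∈ Finset.range (M * N),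
          h ((k : ZMod (M * N)), (l : ZMod (M * N))) *
            amb M N x x (k' - (k : ZMod (M * N))) (l' - (l : ZMod (M * N))) *
            eFrac (M * N) ((((l : ZMod (M * N)) * (k' - (k : ZMod (M * N)))).val : ℤ)) := by
  intro k' l'
  have : NeZero (M * N) := ⟨(Nat.mul_pos hM hN).ne'⟩
  simp only [eFrac_val] at hy ⊢
  simp only [amb_eq_sum_zmod, hy, Finset.mul_sum, Finset.sum_mul]
  rw [Finset.sum_comm]
  refine Finset.sum_congr rfl fun k _ => ?_
  rw [Finset.sum_comm]
  refine Finset.sum_congr rfl fun l _ => ?_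
  generalize (k : ZMod (M * N)) = a, (l : ZMod (M * N)) = b
  rw [← Equiv.sum_comp (Equiv.addRight a)]
  refine Finset.sum_congr rfl fun n _ => ?_
  have hchar : ZMod.stdAddChar (b * n) * ZMod.stdAddChar (-(l' * (n + a - k'))) =
      ZMod.stdAddChar (-((l' - b) * (n + a - k'))) * ZMod.stdAddChar (b * (k' - a)) := by
    rw [← AddChar.map_add_eq_mul, ← AddChar.map_add_eq_mul]
    congr 1
    ring
  have hshift : n - (k' - a) = n + a - k' := by ring
  simp only [Equiv.coe_addRight, add_sub_cancel_right, hshift]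
  linear_combination (((M * N : ℕ) : ℂ)⁻¹ * h (a, b) * x n *
    (starRingEnd ℂ) (x (n + a - k'))) * hchar
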